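/- arXiv:2201.11137 — 2 statements merged into one kernel-verified Lean document; each statement's English description precedes it below -/
import Mathlib

section
/- Let V : ℝⁿ → ℝ be differentiable and let (θ, π) : ℝ → ℝⁿ × ℝⁿ be a differentiable curve with V(θ(t)) > 0 for all t, satisfying the Born–Infeld equations of motion θ̇ᵢ = πᵢ V(θ)/E and π̇ᵢ = −(∂ᵢV(θ)/2)(E/V(θ) + V(θ)/E), where E(t) := √(V(θ(t))(V(θ(t)) + |π(t)|²)). Then E is constant in t (energy conservation: dE/dt = 0). -/
theorem EuclideanSpace.sum_mul_apply_single {n : ℕ} (L : EuclideanSpace ℝ (Fin n) →L[ℝ] ℝ)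
    (x : EuclideanSpace ℝ (Fin n)) :
    ∑ i, x i * L (EuclideanSpace.single i 1) = L x := by
  conv_rhs => rw [← (EuclideanSpace.basisFun (Fin n) ℝ).sum_repr x]
  simp [map_sum]


/-- **Energy conservation for Born–Infeld dynamics.**
If `V : ℝⁿ → ℝ` is differentiable and `(θ, π)` is a differentiable curve with
`V (θ t) > 0` for all `t`, satisfying the Born–Infeld equations of motion
`θ̇ᵢ = πᵢ V(θ)/E` and `π̇ᵢ = −(∂ᵢV(θ)/2)(E/V(θ) + V(θ)/E)`, where
`E t = √(V(θ t)(V(θ t) + ‖π t‖²))`, then `E` is constant in `t`. -/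
theorem bornInfeld_energy_conservation
    (n : ℕ) (V : EuclideanSpace ℝ (Fin n) → ℝ) (hV : Differentiable ℝ V)
    (θ π : ℝ → EuclideanSpace ℝ (Fin n))
    (hθ : Differentiable ℝ θ) (hπ : Differentiable ℝ π)
    (hpos : ∀ t, 0 < V (θ t))
    (E : ℝ → ℝ)
    (hE : ∀ t, E t = Real.sqrt (V (θ t) * (V (θ t) + ‖π t‖ ^ 2)))
    (heomθ : ∀ t, deriv θ t = (V (θ t) / E t) • π t)
    (heomπ : ∀ t i, deriv π t i
      = -(fderiv ℝ V (θ t) (EuclideanSpace.single i 1) / 2)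
          * (E t / V (θ t) + V (θ t) / E t)) :
    ∀ t, E t = E 0 := by
  have hsq : ∀ t, E t ^ 2 = V (θ t) * (V (θ t) + ‖π t‖ ^ 2) := fun t ↦ by
    have := hpos t
    rw [hE t, Real.sq_sqrt (by positivity)]
  have hEpos : ∀ t, 0 < E t := fun t ↦ by
    have := hpos t
    rw [hE t]
    positivity
  have hderiv : ∀ t, HasDerivAt (fun s ↦ V (θ s) * (V (θ s) + ‖π s‖ ^ 2)) 0 t := by
    intro t
    have hVθ : HasDerivAt (fun s ↦ V (θ s)) (fderiv ℝ V (θ t) (deriv θ t)) t :=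
      (hV (θ t)).hasFDerivAt.comp_hasDerivAt t (hθ t).hasDerivAt
    have hinner : inner ℝ (π t) (deriv π t)
        = -(fderiv ℝ V (θ t) (π t) / 2) * (E t / V (θ t) + V (θ t) / E t) := by
      rw [← EuclideanSpace.sum_mul_apply_single (fderiv ℝ V (θ t)) (π t), PiLp.inner_apply,
        Finset.sum_div, ← Finset.sum_neg_distrib, Finset.sum_mul]
      refine Finset.sum_congr rfl fun i _ ↦ ?_
      rw [heomπ t i]
      simp only [RCLike.inner_apply, conj_trivial]
      ring
    refine (hVθ.mul (hVθ.add (hπ t).hasDerivAt.norm_sq)).congr_deriv ?_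
    rw [Pi.add_apply, hinner, heomθ t, map_smul, smul_eq_mul]
    have hVne := (hpos t).ne'
    have hEne := (hEpos t).ne'
    field_simp
    linear_combination (-fderiv ℝ V (θ t) (π t)) * hsq t
  intro t
  rw [hE t, hE 0]
  congr 1
  exact is_const_of_deriv_eq_zero (fun s ↦ (hderiv s).differentiableAt)
    (fun s ↦ (hderiv s).deriv) t 0
end

section
/- Let n ≥ 2 be an integer. Then lim_{V → 0⁺} (1 / (−log V)) ∫₀¹ η^{n−1} (V + η²/2)^{−n/2} dη = 2^{n/2 − 1}. (The phase-space volume of a basin around a minimum with value V_I diverges logarithmically, Vol(M_I) ∝ −log V_I, as V_I → 0: minima with vanishing loss dominate the phase-space volume.) -/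
open MeasureTheory

/-- The basin integrand factors as `η / D` times a power of `1 - V / D`, where `D = V + η² / 2`. -/
lemma basin_integrand_eq {n : ℕ} (hn : 2 ≤ n) {V η : ℝ} (hV : 0 < V) (hη : 0 < η) :
    η ^ (n - 1) * (V + η ^ 2 / 2) ^ (-(n : ℝ) / 2) =
      2 ^ ((n : ℝ) / 2 - 1) *
        (η / (V + η ^ 2 / 2) * (1 - V / (V + η ^ 2 / 2)) ^ ((n : ℝ) / 2 - 1)) := by
  have hD : 0 < V + η ^ 2 / 2 := by positivity
  have hx : 1 - V / (V + η ^ 2 / 2) = η ^ 2 / 2 / (V + η ^ 2 / 2) := by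
    field_simp
    ring
  have h1 : η ^ (n - 1) = η * (η ^ 2) ^ ((n : ℝ) / 2 - 1) := by
    rw [← Real.rpow_natCast η 2, ← Real.rpow_mul hη.le, ← Real.rpow_natCast,
      ← Real.rpow_one_add' hη.le]
    · congr 1
      rw [Nat.cast_sub (by omega)]
      push_cast
      ring
    · have : (2 : ℝ) ≤ n := by exact_mod_cast hn
      push_cast
      linarith
  have h2 : (V + η ^ 2 / 2) ^ (-(n : ℝ) / 2) =
      (V + η ^ 2 / 2)⁻¹ * ((V + η ^ 2 / 2) ^ ((n : ℝ) / 2 - 1))⁻¹ := by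
    rw [← Real.rpow_neg_one, ← Real.rpow_neg hD.le, ← Real.rpow_add hD]
    congr 1
    ring
  have h3 : (2 : ℝ) ^ ((n : ℝ) / 2 - 1) ≠ 0 := by positivity
  rw [h1, h2, hx, Real.div_rpow (by positivity) hD.le, Real.div_rpow (by positivity) (by norm_num)]
  field_simp

lemma basin_integrand_le {n : ℕ} (hn : 2 ≤ n) {V η : ℝ} (hV : 0 < V) (hη : 0 < η) :
    η ^ (n - 1) * (V + η ^ 2 / 2) ^ (-(n : ℝ) / 2) ≤
      2 ^ ((n : ℝ) / 2 - 1) * (η / (V + η ^ 2 / 2)) := by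
  have hn' : (2 : ℝ) ≤ n := by exact_mod_cast hn
  have hx : V / (V + η ^ 2 / 2) ≤ 1 := (div_le_one (by positivity)).2 (by nlinarith)
  have hx0 : 0 < V / (V + η ^ 2 / 2) := by positivity
  rw [basin_integrand_eq hn hV hη]
  gcongr
  exact mul_le_of_le_one_right (by positivity)
    (Real.rpow_le_one (by linarith) (by linarith) (by linarith))

lemma le_basin_integrand {n : ℕ} (hn : 2 ≤ n) {V η : ℝ} (hV : 0 < V) (hη : 0 < η) :
    2 ^ ((n : ℝ) / 2 - 1) *
        (η / (V + η ^ 2 / 2) - (n : ℝ) / 2 * (V * η / (V + η ^ 2 / 2) ^ 2)) ≤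
      η ^ (n - 1) * (V + η ^ 2 / 2) ^ (-(n : ℝ) / 2) := by
  have hn' : (2 : ℝ) ≤ n := by exact_mod_cast hn
  have hx : V / (V + η ^ 2 / 2) < 1 := (div_lt_one (by positivity)).2 (by nlinarith)
  have hx0 : 0 < V / (V + η ^ 2 / 2) := by positivity
  have hbern : 1 + (n : ℝ) / 2 * -(V / (V + η ^ 2 / 2)) ≤
      (1 - V / (V + η ^ 2 / 2)) ^ ((n : ℝ) / 2 - 1) :=
    (one_add_mul_self_le_rpow_one_add (by linarith) (by linarith)).trans
      (Real.rpow_le_rpow_of_exponent_ge (by linarith) (by linarith) (by linarith))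
  rw [basin_integrand_eq hn hV hη]
  gcongr
  calc _ = η / (V + η ^ 2 / 2) * (1 + (n : ℝ) / 2 * -(V / (V + η ^ 2 / 2))) := by
        field_simp
        ring
    _ ≤ _ := by gcongr

lemma continuous_basin_integrand (n : ℕ) {V : ℝ} (hV : 0 < V) :
    Continuous fun η : ℝ => η ^ (n - 1) * (V + η ^ 2 / 2) ^ (-(n : ℝ) / 2) :=
  (continuous_pow _).mul <| Continuous.rpow_const (by fun_prop) fun η =>
    Or.inl (by positivity)

lemma continuous_div_add_sq {V : ℝ} (hV : 0 < V) :
    Continuous fun η : ℝ => η / (V + η ^ 2 / 2) :=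
  continuous_id.div (by fun_prop) fun η => by positivity

lemma continuous_mul_div_add_sq_sq {V : ℝ} (hV : 0 < V) :
    Continuous fun η : ℝ => V * η / (V + η ^ 2 / 2) ^ 2 :=
  Continuous.div (by fun_prop) (by fun_prop) fun η => by positivity

lemma hasDerivAt_add_sq_half (V η : ℝ) : HasDerivAt (fun η : ℝ => V + η ^ 2 / 2) η η :=
  (((hasDerivAt_pow 2 η).div_const 2).const_add V).congr_deriv (by norm_num)

lemma integral_div_add_sq {V : ℝ} (hV : 0 < V) :
    ∫ η in (0 : ℝ)..1, η / (V + η ^ 2 / 2) = Real.log (V + 1 / 2) - Real.log V := by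
  rw [intervalIntegral.integral_eq_sub_of_hasDerivAt (f := fun η => Real.log (V + η ^ 2 / 2))
    (fun η _ => (hasDerivAt_add_sq_half V η).log (by positivity))
    ((continuous_div_add_sq hV).intervalIntegrable _ _)]
  norm_num

lemma integral_mul_div_add_sq_sq_le {V : ℝ} (hV : 0 < V) :
    ∫ η in (0 : ℝ)..1, V * η / (V + η ^ 2 / 2) ^ 2 ≤ 1 := by
  rw [intervalIntegral.integral_eq_sub_of_hasDerivAt (f := fun η => -V * (V + η ^ 2 / 2)⁻¹)
    (fun η _ => (((hasDerivAt_add_sq_half V η).inv (by positivity)).const_mul (-V)).congr_deriv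
      (by ring))
    ((continuous_mul_div_add_sq_sq hV).intervalIntegrable _ _)]
  have h : 0 ≤ V * (V + 1 ^ 2 / 2)⁻¹ := by positivity
  have h' : V * (V + 0 ^ 2 / 2)⁻¹ = 1 := by
    field_simp
    ring
  linarith

lemma basin_integral_le {n : ℕ} (hn : 2 ≤ n) {V : ℝ} (hV : 0 < V) :
    ∫ η in (0 : ℝ)..1, η ^ (n - 1) * (V + η ^ 2 / 2) ^ (-(n : ℝ) / 2) ≤
      2 ^ ((n : ℝ) / 2 - 1) * (Real.log (V + 1 / 2) - Real.log V) := by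
  rw [← integral_div_add_sq hV, ← intervalIntegral.integral_const_mul]
  exact intervalIntegral.integral_mono_on_of_le_Ioo zero_le_one
    ((continuous_basin_integrand n hV).intervalIntegrable _ _)
    (((continuous_div_add_sq hV).const_mul _).intervalIntegrable _ _)
    fun η hη => basin_integrand_le hn hV hη.1

lemma le_basin_integral {n : ℕ} (hn : 2 ≤ n) {V : ℝ} (hV : 0 < V) :
    2 ^ ((n : ℝ) / 2 - 1) * (Real.log (V + 1 / 2) - Real.log V - (n : ℝ) / 2) ≤
      ∫ η in (0 : ℝ)..1, η ^ (n - 1) * (V + η ^ 2 / 2) ^ (-(n : ℝ) / 2) := by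
  have hc := continuous_div_add_sq hV
  have hc' := (continuous_mul_div_add_sq_sq hV).const_mul ((n : ℝ) / 2)
  calc _ ≤ 2 ^ ((n : ℝ) / 2 - 1) * (Real.log (V + 1 / 2) - Real.log V -
          (n : ℝ) / 2 * ∫ η in (0 : ℝ)..1, V * η / (V + η ^ 2 / 2) ^ 2) := by
        gcongr
        exact mul_le_of_le_one_right (by positivity) (integral_mul_div_add_sq_sq_le hV)
    _ = ∫ η in (0 : ℝ)..1, 2 ^ ((n : ℝ) / 2 - 1) *
          (η / (V + η ^ 2 / 2) - (n : ℝ) / 2 * (V * η / (V + η ^ 2 / 2) ^ 2)) := by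
        rw [intervalIntegral.integral_const_mul, intervalIntegral.integral_sub
          (hc.intervalIntegrable _ _) (hc'.intervalIntegrable _ _),
          intervalIntegral.integral_const_mul, integral_div_add_sq hV]
    _ ≤ _ := intervalIntegral.integral_mono_on_of_le_Ioo zero_le_one
        (((hc.sub hc').const_mul _).intervalIntegrable _ _)
        ((continuous_basin_integrand n hV).intervalIntegrable _ _)
        fun η hη => le_basin_integrand hn hV hη.1

lemma tendsto_one_div_neg_log_mul (a c : ℝ) :
    Filter.Tendsto
      (fun V : ℝ => 1 / (-Real.log V) * (a * (Real.log (V + 1 / 2) - Real.log V - c)))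
      (nhdsWithin 0 (Set.Ioi 0)) (nhds a) := by
  have hlog : Filter.Tendsto (fun V : ℝ => -Real.log V) (nhdsWithin 0 (Set.Ioi 0)) Filter.atTop :=
    Filter.tendsto_neg_atBot_atTop.comp Real.tendsto_log_nhdsGT_zero
  have hbdd : Filter.Tendsto (fun V : ℝ => Real.log (V + 1 / 2) - c) (nhdsWithin 0 (Set.Ioi 0))
      (nhds (Real.log (0 + 1 / 2) - c)) := by
    refine Filter.Tendsto.mono_left ?_ nhdsWithin_le_nhds
    exact (((continuous_id.add continuous_const).tendsto 0).log (by norm_num)).sub_const c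
  have h := ((hbdd.div_atTop hlog).const_add 1).const_mul a
  rw [add_zero, mul_one] at h
  refine h.congr' ?_
  filter_upwards [hlog.eventually_gt_atTop 0] with V hV
  have hV' : Real.log V ≠ 0 := (neg_pos.1 hV).ne
  field_simp
  ring

/-- **Logarithmic divergence of the basin phase-space volume as the minimum value `V → 0⁺`.**
For an integer `n ≥ 2`,
`(1/(−log V)) ∫₀¹ η^{n−1} (V + η²/2)^{−n/2} dη → 2^{n/2 − 1}` as `V → 0⁺`. -/
theorem basin_volume_log_divergence
    (n : ℕ) (hn : 2 ≤ n) :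
    Filter.Tendsto
      (fun V : ℝ =>
        (1 / (-Real.log V)) * ∫ η in (0 : ℝ)..1, η ^ (n - 1) * (V + η ^ 2 / 2) ^ (-(n : ℝ) / 2))
      (nhdsWithin 0 (Set.Ioi 0))
      (nhds (2 ^ ((n : ℝ) / 2 - 1))) := by
  have hlog : ∀ᶠ V : ℝ in nhdsWithin 0 (Set.Ioi 0), 0 < -Real.log V :=
    (Filter.tendsto_neg_atBot_atTop.comp Real.tendsto_log_nhdsGT_zero).eventually_gt_atTop 0
  refine tendsto_of_tendsto_of_tendsto_of_le_of_le'
    (tendsto_one_div_neg_log_mul _ ((n : ℝ) / 2)) (tendsto_one_div_neg_log_mul _ 0) ?_ ?_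
  · filter_upwards [hlog, self_mem_nhdsWithin] with V hV hV0
    exact mul_le_mul_of_nonneg_left (le_basin_integral hn hV0) (by positivity)
  · filter_upwards [hlog, self_mem_nhdsWithin] with V hV hV0
    rw [sub_zero]
    exact mul_le_mul_of_nonneg_left (basin_integral_le hn hV0) (by positivity)
end
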